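/- arXiv:2508.13210 — 2 statements merged into one kernel-verified Lean document; each statement's English description precedes it below -/
import Mathlib

section
/- Let G be a finite simple graph with a strong set-coloring f with respect to a color set X. For each edge e = uv ∈ E(G), let T_e = {f(u), f(v), f(uv)}. Then for any two distinct edges e₁ ≠ e₂ of G, the triples T_{e₁} and T_{e₂} intersect in at most one element; equivalently, every pair of distinct nonempty subsets of X lies in at most one of the triples T_e, so the family {T_e : e ∈ E(G)} is a packing. -/
open scoped symmDiff

/-- A strong set-coloring of a simple graph `G` with color set `X`. -/
def IsStrongSetColoring {V X : Type*} (G : SimpleGraph V)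
    (f : V ⊕ G.edgeSet → Set X) : Prop :=
  Function.Injective f ∧
  (∀ z, (f z).Nonempty) ∧
  (∀ s : Set X, s.Nonempty → ∃ z, f z = s) ∧
  ∀ ⦃u v : V⦄ (h : G.Adj u v),
    f (Sum.inr ⟨s(u, v), (G.mem_edgeSet).mpr h⟩) =
      f (Sum.inl u) ∆ f (Sum.inl v)

/-- The triple `T_e = {f(u), f(v), f(uv)}` associated to an edge `uv`. -/
def edgeTriple {V X : Type*} (G : SimpleGraph V) (f : V ⊕ G.edgeSet → Set X)
    {u v : V} (h : G.Adj u v) : Set (Set X) :=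
  {f (Sum.inl u), f (Sum.inl v), f (Sum.inr ⟨s(u, v), (G.mem_edgeSet).mpr h⟩)}

theorem edgeTriple_closed {V X : Type*} (G : SimpleGraph V)
    (f : V ⊕ G.edgeSet → Set X) (hf : IsStrongSetColoring G f) {u v : V} (h : G.Adj u v)
    {s t : Set X} (hst : s ≠ t) (hs : s ∈ edgeTriple G f h) (ht : t ∈ edgeTriple G f h) :
    edgeTriple G f h = {s, t, s ∆ t} := by
  have e := hf.2.2.2 h
  unfold edgeTriple at *
  rw [e] at hs ht ⊢
  generalize f (Sum.inl u) = a at *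
  generalize f (Sum.inl v) = b at *
  have h1 : a ∆ (a ∆ b) = b := symmDiff_symmDiff_cancel_left a b
  have h2 : b ∆ (a ∆ b) = a := by rw [symmDiff_comm a b, symmDiff_symmDiff_cancel_left]
  have h3 : (a ∆ b) ∆ a = b := by rw [symmDiff_comm, h1]
  have h4 : (a ∆ b) ∆ b = a := by rw [symmDiff_comm, h2]
  have h5 : b ∆ a = a ∆ b := symmDiff_comm b a
  simp only [Set.mem_insert_iff, Set.mem_singleton_iff] at hs ht
  rcases hs with rfl | rfl | rfl <;> rcases ht with rfl | rfl | rfl <;>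
    first
    | exact absurd rfl hst
    | (ext x
       simp only [Set.mem_insert_iff, Set.mem_singleton_iff, h1, h2, h3, h4, h5]
         <;> tauto)

/-- If `f` is a strong set-coloring of `G`, the triples of two
distinct edges intersect in at most one element; equivalently, every pair of
distinct nonempty subsets of `X` lies in at most one of the triples, so the
family of triples is a packing. -/
theorem statement4 {V X : Type*} [Fintype V] [Fintype X] (G : SimpleGraph V)
    (f : V ⊕ G.edgeSet → Set X) (hf : IsStrongSetColoring G f) :
    (∀ ⦃u v u' v' : V⦄ (h : G.Adj u v) (h' : G.Adj u' v'),
      s(u, v) ≠ s(u', v') →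
        (edgeTriple G f h ∩ edgeTriple G f h').Subsingleton) ∧
    (∀ s t : Set X, s.Nonempty → t.Nonempty → s ≠ t →
      ∀ ⦃u v u' v' : V⦄ (h : G.Adj u v) (h' : G.Adj u' v'),
        s ∈ edgeTriple G f h → t ∈ edgeTriple G f h →
        s ∈ edgeTriple G f h' → t ∈ edgeTriple G f h' →
          s(u, v) = s(u', v')) := by
  have key : ∀ s t : Set X, s ≠ t →
      ∀ ⦃u v u' v' : V⦄ (h : G.Adj u v) (h' : G.Adj u' v'),
        s ∈ edgeTriple G f h → t ∈ edgeTriple G f h →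
        s ∈ edgeTriple G f h' → t ∈ edgeTriple G f h' →
          s(u, v) = s(u', v') := by
    intro s t hst u v u' v' h h' hs ht hs' ht'
    have e := (edgeTriple_closed G f hf h hst hs ht).trans
      (edgeTriple_closed G f hf h' hst hs' ht').symm
    have m : f (Sum.inr ⟨s(u, v), (G.mem_edgeSet).mpr h⟩) ∈ edgeTriple G f h := by
      simp [edgeTriple]
    rw [e] at m
    rcases m with m | m | m
    · cases hf.1 m
    · cases hf.1 m
    · exact congrArg Subtype.val (Sum.inr.inj (hf.1 m))
  refine ⟨fun u v u' v' h h' hne s hs t ht => ?_, fun s t _ _ hst => key s t hst⟩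
  by_contra hst
  exact hne (key s t hst h h' hs.1 ht.1 hs.2 ht.2)
end

section
/- Let G be a finite simple graph with a strong set-coloring f with respect to a color set X with |X| = n, and let g denote the composition of f with the indicator-function identification of subsets of X with vectors of F₂ⁿ. Then the map sending each edge e = uv ∈ E(G) to the triple {g(u), g(v), g(uv)} is an injective map from E(G) into the set of lines of PG(n−1,2); that is, distinct edges of G are assigned distinct lines. -/
open scoped symmDiff

/-- The lines of `PG(n-1,2)`, realized as the zero-sum triples of nonzero
vectors of `F₂ⁿ`. -/
def projLines (n : ℕ) : Set (Finset (Fin n → ZMod 2)) :=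
  {L | L.card = 3 ∧ (∀ x ∈ L, x ≠ 0) ∧ L.sum id = 0}

/-- If `f` is a strong set-coloring of `G` with color set `Fin n`
and `g` is the composition of `f` with the indicator identification, then the
map sending each edge `uv` to the triple `{g u, g v, g uv}` is an injective
map from `E(G)` into the lines of `PG(n-1,2)`: each triple is a line, and
distinct edges receive distinct lines. -/
theorem statement12 {V : Type*} [Fintype V] (G : SimpleGraph V) (n : ℕ)
    (f : V ⊕ G.edgeSet → Set (Fin n)) (hf : IsStrongSetColoring G f)
    (g : V ⊕ G.edgeSet → (Fin n → ZMod 2))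
    (hg : ∀ z, g z = (f z).indicator fun _ => (1 : ZMod 2)) :
    (∀ ⦃u v : V⦄ (h : G.Adj u v),
      ({g (Sum.inl u), g (Sum.inl v),
          g (Sum.inr ⟨s(u, v), (G.mem_edgeSet).mpr h⟩)} :
        Finset (Fin n → ZMod 2)) ∈ projLines n) ∧
    (∀ ⦃u v u' v' : V⦄ (h : G.Adj u v) (h' : G.Adj u' v'),
      ({g (Sum.inl u), g (Sum.inl v),
          g (Sum.inr ⟨s(u, v), (G.mem_edgeSet).mpr h⟩)} :
        Finset (Fin n → ZMod 2)) =
        ({g (Sum.inl u'), g (Sum.inl v'),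
            g (Sum.inr ⟨s(u', v'), (G.mem_edgeSet).mpr h'⟩)} :
          Finset (Fin n → ZMod 2)) →
      s(u, v) = s(u', v')) := by
  obtain ⟨hinj, hne, -, hadd⟩ := hf
  have ginj : Function.Injective g := by
    intro a b hab
    apply hinj
    rw [hg, hg] at hab
    ext i
    have hi := congrFun hab i
    by_cases ha : i ∈ f a <;> by_cases hb : i ∈ f b <;> simp_all
  have gne : ∀ z, g z ≠ 0 := by
    intro z hz
    obtain ⟨i, hi⟩ := hne z
    have hi' := congrFun hz i
    rw [hg] at hi'
    simp [hi] at hi'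
  refine ⟨?_, ?_⟩
  · intro u v h
    have h1 : g (Sum.inl u) ≠ g (Sum.inl v) := fun e =>
      h.ne (Sum.inl_injective (ginj e))
    have h2 : g (Sum.inl u) ≠ g (Sum.inr ⟨s(u, v), (G.mem_edgeSet).mpr h⟩) := fun e =>
      Sum.inl_ne_inr (ginj e)
    have h3 : g (Sum.inl v) ≠ g (Sum.inr ⟨s(u, v), (G.mem_edgeSet).mpr h⟩) := fun e =>
      Sum.inl_ne_inr (ginj e)
    refine ⟨Finset.card_eq_three.mpr ⟨_, _, _, h1, h2, h3, rfl⟩, ?_, ?_⟩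
    · intro x hx
      simp only [Finset.mem_insert, Finset.mem_singleton] at hx
      rcases hx with rfl | rfl | rfl <;> exact gne _
    · rw [Finset.sum_insert (by simp [h1, h2]), Finset.sum_insert (by simp [h3]),
        Finset.sum_singleton]
      simp only [id]
      rw [hg, hg, hg, hadd h]
      have two : (1 : ZMod 2) + 1 = 0 := by decide
      ext i
      by_cases ha : i ∈ f (Sum.inl u) <;> by_cases hb : i ∈ f (Sum.inl v) <;>
        simp [Set.indicator, Set.mem_symmDiff, ha, hb, two]
  · intro u v u' v' h h' heq
    have hm : g (Sum.inr ⟨s(u, v), (G.mem_edgeSet).mpr h⟩) ∈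
        ({g (Sum.inl u'), g (Sum.inl v'),
            g (Sum.inr ⟨s(u', v'), (G.mem_edgeSet).mpr h'⟩)} :
          Finset (Fin n → ZMod 2)) := by
      rw [← heq]
      simp
    simp only [Finset.mem_insert, Finset.mem_singleton] at hm
    rcases hm with e | e | e
    · exact absurd (ginj e) Sum.inr_ne_inl
    · exact absurd (ginj e) Sum.inr_ne_inl
    · exact congrArg Subtype.val (Sum.inr_injective (ginj e))
end
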